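/- arXiv:2210.15267 — 2 statements merged into one kernel-verified Lean document; each statement's English description precedes it below -/
import Mathlib

section
/- Let f : X → ℂ be measurable with ∫_X ω^{−2}|f|² dμ < ∞, let E ≥ 0 be real, and let z ∈ ℂ with Im z ≠ 0. Then the function k ↦ |f(k)|²·(1/(ω(k) + E − z) − 1/(ω(k) + 1)) is μ-integrable. (This convergent renormalized integral is the scalar building block of the renormalized self-energy operator S̃_f(z) that replaces the divergent expression a(f)(dΓ(ω) − z)^{−1}a†(f) when f ∈ H_{−2} \ H_{−1}.) -/
open MeasureTheory ENNReal

lemma mul_abs_im_le_norm_ofReal_sub_mul_norm (x : ℝ) (z : ℂ) :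
    x * |z.im| ≤ ‖(x : ℂ) - z‖ * ‖z‖ := by
  have h := Complex.abs_im_le_norm (((x : ℂ) - z) * (starRingEnd ℂ) z)
  have him : (((x : ℂ) - z) * (starRingEnd ℂ) z).im = -(x * z.im) := by
    simp [Complex.mul_im]
    ring
  rw [him, abs_neg, abs_mul, norm_mul, Complex.norm_conj] at h
  exact (mul_le_mul_of_nonneg_right (le_abs_self x) (abs_nonneg _)).trans h

lemma norm_one_div_sub_one_div_le {w E : ℝ} (hw : 0 < w) (hE : 0 ≤ E) {z : ℂ} (hz : z.im ≠ 0) :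
    ‖1 / ((w : ℂ) + (E : ℂ) - z) - 1 / ((w : ℂ) + 1)‖ ≤
      ‖1 - E + z‖ * ‖z‖ / |z.im| * w ^ (-2 : ℝ) := by
  have him : 0 < |z.im| := abs_pos.2 hz
  have hzn : 0 < ‖z‖ := norm_pos_iff.2 fun h => hz (by simp [h])
  have hA : w * |z.im| ≤ ‖(w : ℂ) + (E : ℂ) - z‖ * ‖z‖ := by
    have h := mul_abs_im_le_norm_ofReal_sub_mul_norm (w + E) z
    push_cast at h
    nlinarith [mul_nonneg hE him.le]
  have hA0 : 0 < ‖(w : ℂ) + (E : ℂ) - z‖ :=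
    pos_of_mul_pos_left ((mul_pos hw him).trans_le hA) hzn.le
  have hB : w ≤ ‖(w : ℂ) + 1‖ := by
    have h := Complex.re_le_norm ((w : ℂ) + 1)
    simp only [Complex.add_re, Complex.ofReal_re, Complex.one_re] at h
    linarith
  have hB0 : 0 < ‖(w : ℂ) + 1‖ := hw.trans_le hB
  rw [div_sub_div _ _ (norm_pos_iff.1 hA0) (norm_pos_iff.1 hB0), norm_div, norm_mul,
    show 1 * ((w : ℂ) + 1) - ((w : ℂ) + (E : ℂ) - z) * 1 = 1 - E + z by ring,
    Real.rpow_neg hw.le, Real.rpow_two, ← div_eq_mul_inv, div_div,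
    div_le_div_iff₀ (mul_pos hA0 hB0) (by positivity), mul_assoc]
  refine mul_le_mul_of_nonneg_left ?_ (norm_nonneg _)
  calc |z.im| * w ^ 2 = (w * |z.im|) * w := by ring
    _ ≤ (‖(w : ℂ) + (E : ℂ) - z‖ * ‖z‖) * ‖(w : ℂ) + 1‖ :=
      mul_le_mul hA hB hw.le (by positivity)
    _ = ‖z‖ * (‖(w : ℂ) + (E : ℂ) - z‖ * ‖(w : ℂ) + 1‖) := by ring

/-- For `f ∈ H_{−2}`, `E ≥ 0` and non-real `z`, the function
`k ↦ |f(k)|²(1/(ω(k)+E−z) − 1/(ω(k)+1))` is `μ`-integrable (the scalar building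
block of the renormalized self-energy `S̃_f(z)`). -/
theorem renormalized_selfEnergy_integrand_integrable
    {X : Type*} [MeasurableSpace X] (μ : Measure X)
    (ω : X → ℝ) (hω : Measurable ω) (m : ℝ) (hm : 0 < m) (hωm : ∀ k, m ≤ ω k)
    (f : X → ℂ) (hf : Measurable f)
    (hf2 : (∫⁻ k, ENNReal.ofReal (ω k ^ (-2 : ℝ) * ‖f k‖ ^ 2) ∂μ) ≠ ⊤)
    (E : ℝ) (hE : 0 ≤ E) (z : ℂ) (hz : z.im ≠ 0) :
    Integrable
      (fun k => (‖f k‖ ^ 2 : ℂ) *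
        (1 / ((ω k : ℂ) + (E : ℂ) - z) - 1 / ((ω k : ℂ) + 1))) μ := by
  have hpos : ∀ k, 0 < ω k := fun k => hm.trans_le (hωm k)
  have hdom : Integrable (fun k => ω k ^ (-2 : ℝ) * ‖f k‖ ^ 2) μ := by
    refine ⟨by fun_prop, ?_⟩
    rw [hasFiniteIntegral_iff_ofReal (.of_forall fun k =>
      mul_nonneg (Real.rpow_nonneg (hpos k).le _) (sq_nonneg _))]
    exact hf2.lt_top
  refine (hdom.const_mul (‖1 - E + z‖ * ‖z‖ / |z.im|)).mono'
    (Measurable.aestronglyMeasurable (by fun_prop)) (.of_forall fun k => ?_)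
  rw [norm_mul, norm_pow, Complex.norm_real, norm_norm, ← mul_assoc, mul_comm]
  exact mul_le_mul_of_nonneg_right (norm_one_div_sub_one_div_le (hpos k) hE hz) (sq_nonneg _)
end

section
/- Let f : X → ℂ be measurable with ∫_X ω^{−1}|f|² dμ =: ‖f‖_{−1}² < ∞, let n ≥ 0, and let Ψ : Xⁿ → ℂ be measurable, symmetric, and square-integrable with respect to μⁿ. For k = (k_1,…,k_n) ∈ Xⁿ define the integrand g_k(κ) := conj(f(κ)) · (1 + ω(κ) + Σ_{j=1}^n ω(k_j))^{−1} · ( f(κ)Ψ(k_1,…,k_n) + Σ_{j=1}^n f(k_j) Ψ(k_1,…,k_{j−1},κ,k_{j+1},…,k_n) ). Then for μⁿ-almost every k the function g_k is μ-integrable, and the function (SΨ)(k) := ∫_X g_k(κ) dμ(κ) satisfies ∫_{Xⁿ} |SΨ|² dμⁿ ≤ ‖f‖_{−1}⁴ · ∫_{Xⁿ} |Ψ|² dμⁿ. (This is the n-particle-sector content of the boundedness on Fock space of the operator S_f(−1) = a(f)(dΓ(ω) + 1)^{−1} a†(f) for a singular form factor f ∈ H_{−1}.) -/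
open MeasureTheory ENNReal

namespace FockSector

variable {X : Type*} {n : ℕ}

/-- The total energy `ω(κ) + Σ_j ω(k_j)` of the `n + 1` particles `(κ, k)`. -/
def totalEnergy (ω : X → ℝ) (p : X × (Fin n → X)) : ℝ :=
  ω p.1 + ∑ j, ω (p.2 j)

/-- The unnormalized creation operator `√(n+1) a†(f)` on the `n`-particle sector. -/
def creation (f : X → ℂ) (Ψ : (Fin n → X) → ℂ) (p : X × (Fin n → X)) : ℂ :=
  f p.1 * Ψ p.2 + ∑ j, f (p.2 j) * Ψ (Function.update p.2 j p.1)

/-- Exchange of the distinguished particle `κ` with the particle in slot `j`. -/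
def exchange (j : Fin n) (p : X × (Fin n → X)) : X × (Fin n → X) :=
  (p.2 j, Function.update p.2 j p.1)

/-- The squared modulus of the summand `f(κ)Ψ(k)` weighted by `ω(κ)⁻¹`. -/
noncomputable def weightedDensity (ω : X → ℝ) (f : X → ℂ) (Ψ : (Fin n → X) → ℂ)
    (p : X × (Fin n → X)) : ℝ :=
  (ω p.1)⁻¹ * ‖f p.1‖ ^ 2 * ‖Ψ p.2‖ ^ 2

/-- The density `|(dΓ(ω) + 1)⁻¹ a†(f)Ψ|²`, up to normalization. -/
noncomputable def resolventDensity (ω : X → ℝ) (f : X → ℂ) (Ψ : (Fin n → X) → ℂ)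
    (p : X × (Fin n → X)) : ℝ :=
  (1 + totalEnergy ω p)⁻¹ ^ 2 * ‖creation f Ψ p‖ ^ 2

theorem totalEnergy_exchange (ω : X → ℝ) (j : Fin n) (p : X × (Fin n → X)) :
    totalEnergy ω (exchange j p) = totalEnergy ω p := by
  simp only [totalEnergy, exchange]
  rw [← Finset.add_sum_erase _ _ (Finset.mem_univ j),
    ← Finset.add_sum_erase _ (fun i => ω (p.2 i)) (Finset.mem_univ j), Function.update_self,
    Finset.sum_congr rfl fun i hi => by rw [Function.update_of_ne (Finset.ne_of_mem_erase hi)]]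
  ring

theorem creation_exchange (f : X → ℂ) {Ψ : (Fin n → X) → ℂ}
    (hsym : ∀ σ : Equiv.Perm (Fin n), ∀ k : Fin n → X, Ψ (k ∘ σ) = Ψ k)
    (j : Fin n) (p : X × (Fin n → X)) :
    creation f Ψ (exchange j p) = creation f Ψ p := by
  obtain ⟨κ, k⟩ := p
  have hne : ∀ i ∈ Finset.univ.erase j,
      f (Function.update k j κ i) * Ψ (Function.update (Function.update k j κ) i (k j)) =
        f (k i) * Ψ (Function.update k i κ) := by
    intro i hi
    have hij := Finset.ne_of_mem_erase hi
    rw [Function.update_of_ne hij, ← hsym (Equiv.swap i j) (Function.update k i κ)]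
    congr 2
    ext l
    simp only [Function.comp_apply, Function.update_apply, Equiv.swap_apply_def]
    split_ifs <;> simp_all
  simp only [creation, exchange]
  rw [← Finset.add_sum_erase _ _ (Finset.mem_univ j),
    ← Finset.add_sum_erase _ (fun i => f (k i) * Ψ (Function.update k i κ)) (Finset.mem_univ j),
    Finset.sum_congr rfl hne]
  simp only [Function.update_self, Function.update_idem, Function.update_eq_self]
  ring

theorem resolventDensity_exchange (ω : X → ℝ) (f : X → ℂ) {Ψ : (Fin n → X) → ℂ}
    (hsym : ∀ σ : Equiv.Perm (Fin n), ∀ k : Fin n → X, Ψ (k ∘ σ) = Ψ k)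
    (j : Fin n) (p : X × (Fin n → X)) :
    resolventDensity ω f Ψ (exchange j p) = resolventDensity ω f Ψ p := by
  simp only [resolventDensity, totalEnergy_exchange, creation_exchange f hsym]

theorem norm_sum_sq_le_sum_mul_sum {ι : Type*} (s : Finset ι) {w : ι → ℝ}
    (hw : ∀ i ∈ s, 0 < w i) (z : ι → ℂ) :
    ‖∑ i ∈ s, z i‖ ^ 2 ≤ (∑ i ∈ s, w i) * ∑ i ∈ s, (w i)⁻¹ * ‖z i‖ ^ 2 := by
  refine (pow_le_pow_left₀ (norm_nonneg _) (norm_sum_le s z) 2).trans ?_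
  refine Finset.sum_sq_le_sum_mul_sum_of_sq_le_mul s (fun i hi => (hw i hi).le)
    (fun i hi => mul_nonneg (inv_nonneg.2 (hw i hi).le) (sq_nonneg _)) fun i hi => ?_
  rw [mul_inv_cancel_left₀ (hw i hi).ne']

theorem totalEnergy_pos {ω : X → ℝ} (hω : ∀ k, 0 < ω k) (p : X × (Fin n → X)) :
    0 < totalEnergy ω p :=
  add_pos_of_pos_of_nonneg (hω _) (Finset.sum_nonneg fun _ _ => (hω _).le)

theorem norm_creation_sq_le {ω : X → ℝ} (hω : ∀ k, 0 < ω k) (f : X → ℂ)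
    (Ψ : (Fin n → X) → ℂ) (p : X × (Fin n → X)) :
    ‖creation f Ψ p‖ ^ 2 ≤ totalEnergy ω p *
      (weightedDensity ω f Ψ p + ∑ j, weightedDensity ω f Ψ (exchange j p)) := by
  have h := norm_sum_sq_le_sum_mul_sum (Finset.univ : Finset (Option (Fin n)))
    (w := fun i => i.elim (ω p.1) fun j => ω (p.2 j)) (by rintro (_ | j) _ <;> exact hω _)
    fun i => i.elim (f p.1 * Ψ p.2) fun j => f (p.2 j) * Ψ (Function.update p.2 j p.1)
  simpa only [Fintype.sum_option, Option.elim_none, Option.elim_some, norm_mul, mul_pow,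
    ← mul_assoc, creation, totalEnergy, weightedDensity, exchange] using h

theorem weightedDensity_nonneg {ω : X → ℝ} (hω : ∀ k, 0 < ω k) (f : X → ℂ)
    (Ψ : (Fin n → X) → ℂ) (p : X × (Fin n → X)) : 0 ≤ weightedDensity ω f Ψ p := by
  have := hω p.1
  unfold weightedDensity
  positivity

theorem totalEnergy_mul_resolventDensity_le {ω : X → ℝ} (hω : ∀ k, 0 < ω k) (f : X → ℂ)
    (Ψ : (Fin n → X) → ℂ) (p : X × (Fin n → X)) :
    totalEnergy ω p * resolventDensity ω f Ψ p ≤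
      weightedDensity ω f Ψ p + ∑ j, weightedDensity ω f Ψ (exchange j p) := by
  have hE := totalEnergy_pos hω p
  have hW : 0 ≤ weightedDensity ω f Ψ p + ∑ j, weightedDensity ω f Ψ (exchange j p) :=
    add_nonneg (weightedDensity_nonneg hω f Ψ p)
      (Finset.sum_nonneg fun j _ => weightedDensity_nonneg hω f Ψ _)
  have hC := norm_creation_sq_le hω f Ψ p
  unfold resolventDensity
  generalize totalEnergy ω p = E at *
  generalize weightedDensity ω f Ψ p + ∑ j, weightedDensity ω f Ψ (exchange j p) = W at *
  calc E * ((1 + E)⁻¹ ^ 2 * ‖creation f Ψ p‖ ^ 2)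
      ≤ E * ((1 + E)⁻¹ ^ 2 * (E * W)) := by gcongr
    _ = (E / (1 + E)) ^ 2 * W := by ring
    _ ≤ 1 * W := by
        gcongr
        exact pow_le_one₀ (by positivity) ((div_le_one (by positivity)).2 (by linarith))
    _ = W := one_mul W

variable [MeasurableSpace X]

theorem measurePreserving_exchange (μ : Measure X) [SigmaFinite μ] (j : Fin n) :
    MeasurePreserving (exchange j) (μ.prod (Measure.pi fun _ : Fin n => μ))
      (μ.prod (Measure.pi fun _ : Fin n => μ)) := by
  have e := measurePreserving_piFinSuccAbove (fun _ : Fin (n + 1) => μ) 0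
  have s := measurePreserving_piCongrLeft (fun _ : Fin (n + 1) => μ) (Equiv.swap 0 j.succ)
  have h := (e.comp s).comp (e.symm _)
  convert h using 1
  have perm (K : Fin (n + 1) → X) (i : Fin (n + 1)) :
      MeasurableEquiv.piCongrLeft (fun _ : Fin (n + 1) => X) (Equiv.swap 0 j.succ) K i =
        K (Equiv.swap 0 j.succ i) := by
    simpa [MeasurableEquiv.coe_piCongrLeft] using Equiv.piCongrLeft_apply_apply
      (fun _ : Fin (n + 1) => X) (Equiv.swap 0 j.succ) K (Equiv.swap 0 j.succ i)
  funext p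
  ext i
  · simp [exchange, MeasurableEquiv.piFinSuccAbove, perm]
  · obtain rfl | hij := eq_or_ne i j
    · simp [exchange, MeasurableEquiv.piFinSuccAbove, perm, Fin.tail, Fin.consEquiv]
    · simp [exchange, MeasurableEquiv.piFinSuccAbove, perm, Fin.tail, Fin.consEquiv, hij,
        Equiv.swap_apply_of_ne_of_ne]

@[fun_prop]
theorem measurable_totalEnergy {ω : X → ℝ} (hω : Measurable ω) :
    Measurable (totalEnergy ω : X × (Fin n → X) → ℝ) := by
  unfold totalEnergy
  fun_prop

@[fun_prop]
theorem measurable_creation {f : X → ℂ} (hf : Measurable f) {Ψ : (Fin n → X) → ℂ}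
    (hΨ : Measurable Ψ) : Measurable (creation f Ψ) := by
  have (j : Fin n) : Measurable fun p : X × (Fin n → X) => Function.update p.2 j p.1 :=
    measurable_snd.comp (measurePreserving_exchange (0 : Measure X) j).measurable
  unfold creation
  fun_prop

theorem measurable_resolventDensity {ω : X → ℝ} (hω : Measurable ω) {f : X → ℂ}
    (hf : Measurable f) {Ψ : (Fin n → X) → ℂ} (hΨ : Measurable Ψ) :
    Measurable (resolventDensity ω f Ψ) := by
  unfold resolventDensity
  fun_prop

theorem measurable_weightedDensity {ω : X → ℝ} (hω : Measurable ω) {f : X → ℂ}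
    (hf : Measurable f) {Ψ : (Fin n → X) → ℂ} (hΨ : Measurable Ψ) :
    Measurable (weightedDensity ω f Ψ) := by
  unfold weightedDensity
  fun_prop

theorem lintegral_mul_resolventDensity_le (μ : Measure X) [SigmaFinite μ] {ω : X → ℝ}
    (hω : Measurable ω) (hpos : ∀ k, 0 < ω k) {f : X → ℂ} (hf : Measurable f)
    {Ψ : (Fin n → X) → ℂ} (hΨ : Measurable Ψ)
    (hsym : ∀ σ : Equiv.Perm (Fin n), ∀ k : Fin n → X, Ψ (k ∘ σ) = Ψ k) :
    ∫⁻ p, ENNReal.ofReal (ω p.1 * resolventDensity ω f Ψ p)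
        ∂(μ.prod (Measure.pi fun _ : Fin n => μ)) ≤
      ∫⁻ p, ENNReal.ofReal (weightedDensity ω f Ψ p)
        ∂(μ.prod (Measure.pi fun _ : Fin n => μ)) := by
  have hex := measurePreserving_exchange (n := n) μ
  have hR := measurable_resolventDensity hω hf hΨ
  have hW := measurable_weightedDensity hω hf hΨ
  have hRnn (p) : 0 ≤ resolventDensity ω f Ψ p := by unfold resolventDensity; positivity
  set ν := μ.prod (Measure.pi fun _ : Fin n => μ)
  have sum_eq (F : X × (Fin n → X) → ℝ) (hF : Measurable F) (hF0 : ∀ p, 0 ≤ F p) :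
      ∫⁻ p, ENNReal.ofReal (F p + ∑ j, F (exchange j p)) ∂ν =
        (n + 1) * ∫⁻ p, ENNReal.ofReal (F p) ∂ν := by
    have hj (j : Fin n) : Measurable fun p => ENNReal.ofReal (F (exchange j p)) :=
      (hF.comp (hex j).measurable).ennreal_ofReal
    simp_rw [ENNReal.ofReal_add (hF0 _) (Finset.sum_nonneg fun j _ => hF0 (exchange j _)),
      ENNReal.ofReal_sum_of_nonneg fun j _ => hF0 (exchange j _)]
    rw [lintegral_add_left hF.ennreal_ofReal, lintegral_finsetSum _ fun j _ => hj j,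
      Finset.sum_congr rfl fun j _ => (hex j).lintegral_comp hF.ennreal_ofReal]
    simp
    ring
  have key : (n + 1 : ℝ≥0∞) * ∫⁻ p, ENNReal.ofReal (ω p.1 * resolventDensity ω f Ψ p) ∂ν ≤
      (n + 1) * ∫⁻ p, ENNReal.ofReal (weightedDensity ω f Ψ p) ∂ν := by
    rw [← sum_eq _ (by fun_prop) fun p => mul_nonneg (hpos _).le (hRnn p),
      ← sum_eq _ hW (weightedDensity_nonneg hpos f Ψ)]
    refine lintegral_mono fun p => ENNReal.ofReal_le_ofReal ?_
    simp_rw [resolventDensity_exchange ω f hsym, ← Finset.sum_mul, ← add_mul]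
    exact totalEnergy_mul_resolventDensity_le hpos f Ψ p
  exact (ENNReal.mul_le_mul_iff_right (by positivity) (by finiteness)).1 key

theorem lintegral_weightedDensity (μ : Measure X) [SigmaFinite μ] {ω : X → ℝ}
    (hω : Measurable ω) (hpos : ∀ k, 0 < ω k) {f : X → ℂ} (hf : Measurable f)
    {Ψ : (Fin n → X) → ℂ} (hΨ : Measurable Ψ) :
    ∫⁻ p, ENNReal.ofReal (weightedDensity ω f Ψ p)
        ∂(μ.prod (Measure.pi fun _ : Fin n => μ)) =
      (∫⁻ k, ENNReal.ofReal (ω k ^ (-1 : ℝ) * ‖f k‖ ^ 2) ∂μ) *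
        ∫⁻ k, ENNReal.ofReal (‖Ψ k‖ ^ 2) ∂(Measure.pi fun _ : Fin n => μ) := by
  rw [← lintegral_prod_mul (by fun_prop) (by fun_prop)]
  refine lintegral_congr fun p => ?_
  have := hpos p.1
  rw [← ENNReal.ofReal_mul (by positivity), Real.rpow_neg_one, weightedDensity]

theorem sq_lintegral_mul_le (μ : Measure X) {u v : X → ℝ≥0∞} (hu : AEMeasurable u μ)
    (hv : AEMeasurable v μ) :
    (∫⁻ x, u x * v x ∂μ) ^ 2 ≤ (∫⁻ x, u x ^ 2 ∂μ) * ∫⁻ x, v x ^ 2 ∂μ := by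
  have h := ENNReal.lintegral_mul_le_Lp_mul_Lq μ Real.HolderConjugate.two_two hu hv
  calc (∫⁻ x, u x * v x ∂μ) ^ 2
      ≤ ((∫⁻ x, u x ^ (2 : ℝ) ∂μ) ^ (1 / 2 : ℝ) * (∫⁻ x, v x ^ (2 : ℝ) ∂μ) ^ (1 / 2 : ℝ)) ^ 2 := by
        gcongr
        exact h
    _ = _ := by
        rw [mul_pow, ← ENNReal.rpow_mul_natCast, ← ENNReal.rpow_mul_natCast]
        simp

theorem sq_lintegral_enorm_le (μ : Measure X) {ω : X → ℝ} (hω : Measurable ω)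
    (hpos : ∀ k, 0 < ω k) {f : X → ℂ} (hf : Measurable f) {Ψ : (Fin n → X) → ℂ}
    (hΨ : Measurable Ψ) (k : Fin n → X) :
    (∫⁻ κ, ‖(starRingEnd ℂ) (f κ) * ((1 + totalEnergy ω (κ, k) : ℝ) : ℂ)⁻¹ *
        creation f Ψ (κ, k)‖ₑ ∂μ) ^ 2 ≤
      (∫⁻ κ, ENNReal.ofReal (ω κ ^ (-1 : ℝ) * ‖f κ‖ ^ 2) ∂μ) *
        ∫⁻ κ, ENNReal.ofReal (ω κ * resolventDensity ω f Ψ (κ, k)) ∂μ := by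
  have hC : Measurable fun κ => creation f Ψ (κ, k) :=
    (measurable_creation hf hΨ).comp measurable_prodMk_right
  have hE : Measurable fun κ => totalEnergy ω (κ, k) :=
    (measurable_totalEnergy hω).comp measurable_prodMk_right
  have h := sq_lintegral_mul_le μ
    (u := fun κ => ENNReal.ofReal ((√(ω κ))⁻¹ * ‖f κ‖))
    (v := fun κ => ENNReal.ofReal
      (√(ω κ) * ((1 + totalEnergy ω (κ, k))⁻¹ * ‖creation f Ψ (κ, k)‖)))
    (by fun_prop) (by fun_prop)
  convert h using 1
  · congr 1
    refine lintegral_congr fun κ => ?_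
    have h1 := totalEnergy_pos hpos (κ, k)
    have h2 := Real.sqrt_pos.2 (hpos κ)
    rw [← ENNReal.ofReal_mul (by positivity), ← ofReal_norm]
    congr 1
    rw [norm_mul, norm_mul, RCLike.norm_conj, norm_inv, Complex.norm_real, Real.norm_of_nonneg
      (by positivity)]
    field_simp
  · congr 1 <;> refine lintegral_congr fun κ => ?_
    · have h2 := Real.sqrt_pos.2 (hpos κ)
      rw [← ENNReal.ofReal_pow (by positivity), Real.rpow_neg_one, mul_pow, inv_pow,
        Real.sq_sqrt (hpos κ).le]
    · have h1 := totalEnergy_pos hpos (κ, k)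
      rw [← ENNReal.ofReal_pow (by positivity), mul_pow, mul_pow, Real.sq_sqrt (hpos κ).le,
        resolventDensity]

end FockSector

/-- (boundedness of `S_f(−1) = a(f)(dΓ(ω)+1)⁻¹a†(f)` on the
`n`-particle sector for `f ∈ H_{−1}`). For a.e. `k = (k_1,…,k_n)` the integrand
`g_k(κ) = conj(f(κ))(1+ω(κ)+Σ_j ω(k_j))⁻¹(f(κ)Ψ(k) + Σ_j f(k_j)Ψ(k with κ in slot j))`
is integrable, and `(SΨ)(k) := ∫ g_k dμ` satisfies
`∫ |SΨ|² dμⁿ ≤ ‖f‖⁴_{−1} ∫ |Ψ|² dμⁿ`. -/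
theorem selfEnergy_bounded
    {X : Type*} [MeasurableSpace X] (μ : Measure X) [SigmaFinite μ]
    (ω : X → ℝ) (hω : Measurable ω) (m : ℝ) (hm : 0 < m) (hωm : ∀ k, m ≤ ω k)
    (f : X → ℂ) (hf : Measurable f)
    (hf1 : (∫⁻ k, ENNReal.ofReal (ω k ^ (-1 : ℝ) * ‖f k‖ ^ 2) ∂μ) ≠ ⊤)
    (n : ℕ) (Ψ : (Fin n → X) → ℂ) (hΨ : Measurable Ψ)
    (hsym : ∀ σ : Equiv.Perm (Fin n), ∀ k : Fin n → X, Ψ (k ∘ σ) = Ψ k)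
    (hΨ2 : (∫⁻ k, ENNReal.ofReal (‖Ψ k‖ ^ 2) ∂(Measure.pi fun _ : Fin n => μ)) ≠ ⊤) :
    (∀ᵐ k ∂(Measure.pi fun _ : Fin n => μ),
      Integrable
        (fun κ => (starRingEnd ℂ) (f κ) * (((1 + ω κ + ∑ j : Fin n, ω (k j) : ℝ) : ℂ))⁻¹ *
          (f κ * Ψ k + ∑ j : Fin n, f (k j) * Ψ (Function.update k j κ))) μ) ∧
    ∫⁻ k, ENNReal.ofReal
        (‖∫ κ, (starRingEnd ℂ) (f κ) * (((1 + ω κ + ∑ j : Fin n, ω (k j) : ℝ) : ℂ))⁻¹ *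
            (f κ * Ψ k + ∑ j : Fin n, f (k j) * Ψ (Function.update k j κ)) ∂μ‖ ^ 2)
        ∂(Measure.pi fun _ : Fin n => μ) ≤
      (∫⁻ k, ENNReal.ofReal (ω k ^ (-1 : ℝ) * ‖f k‖ ^ 2) ∂μ) ^ 2 *
        ∫⁻ k, ENNReal.ofReal (‖Ψ k‖ ^ 2) ∂(Measure.pi fun _ : Fin n => μ) := by
  have hpos (k) : 0 < ω k := hm.trans_le (hωm k)
  set ν := Measure.pi fun _ : Fin n => μ
  set a := ∫⁻ k, ENNReal.ofReal (ω k ^ (-1 : ℝ) * ‖f k‖ ^ 2) ∂μ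
  set b := ∫⁻ k, ENNReal.ofReal (‖Ψ k‖ ^ 2) ∂ν
  simp_rw [add_assoc (1 : ℝ)]
  have hpt := FockSector.sq_lintegral_enorm_le μ hω hpos hf hΨ
  have hmeas := FockSector.measurable_resolventDensity hω hf hΨ
  have hbound : ∫⁻ k, ∫⁻ κ, ENNReal.ofReal
      (ω κ * FockSector.resolventDensity ω f Ψ (κ, k)) ∂μ ∂ν ≤ a * b := by
    rw [← lintegral_prod_symm' (fun p : X × (Fin n → X) =>
      ENNReal.ofReal (ω p.1 * FockSector.resolventDensity ω f Ψ p)) (by fun_prop)]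
    exact (FockSector.lintegral_mul_resolventDensity_le μ hω hpos hf hΨ hsym).trans_eq
      (FockSector.lintegral_weightedDensity μ hω hpos hf hΨ)
  have hinner : Measurable fun k => ∫⁻ κ, ENNReal.ofReal
      (ω κ * FockSector.resolventDensity ω f Ψ (κ, k)) ∂μ :=
    Measurable.lintegral_prod_left' (f := fun p : X × (Fin n → X) =>
      ENNReal.ofReal (ω p.1 * FockSector.resolventDensity ω f Ψ p)) (by fun_prop)
  refine ⟨?_, ?_⟩
  · filter_upwards [ae_lt_top hinner
      (hbound.trans_lt (ENNReal.mul_lt_top hf1.lt_top hΨ2.lt_top)).ne] with k hk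
    have hC : Measurable fun κ => FockSector.creation f Ψ (κ, k) :=
      (FockSector.measurable_creation hf hΨ).comp measurable_prodMk_right
    have hlt := (hpt k).trans_lt (ENNReal.mul_lt_top hf1.lt_top hk)
    refine ⟨Measurable.aestronglyMeasurable (Measurable.mul (by fun_prop) hC), ?_⟩
    exact (ENNReal.pow_lt_top_iff.1 hlt).resolve_right two_ne_zero
  · calc _ ≤ ∫⁻ k, a * ∫⁻ κ, ENNReal.ofReal
          (ω κ * FockSector.resolventDensity ω f Ψ (κ, k)) ∂μ ∂ν := by
          refine lintegral_mono fun k => le_trans ?_ (hpt k)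
          rw [ENNReal.ofReal_pow (norm_nonneg _), ofReal_norm]
          gcongr
          exact enorm_integral_le_lintegral_enorm _
      _ ≤ a * (a * b) := by
          rw [lintegral_const_mul _ hinner]
          gcongr
      _ = a ^ 2 * b := by ring
end
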